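/- Let F_q be a finite field with q elements, let r ≥ 1 be a natural number, let x_0, x_1, ..., x_r be pairwise distinct elements of F_q, and let y_1, ..., y_r ∈ F_q. Let S = {f ∈ F_q[X] : deg f ≤ r and f(x_i) = y_i for all i = 1, ..., r}; S is finite and nonempty. Then the pushforward of the uniform probability distribution on S under the evaluation map f ↦ f(x_0) is the uniform probability distribution on F_q. -/

import Mathlib

theorem pmf_map_uniform_of_bijective {α β : Type*} [Fintype α] [Nonempty α] [Fintype β]
    [Nonempty β] (g : α → β) (hg : Function.Bijective g) :
    PMF.map g (PMF.uniformOfFintype α) = PMF.uniformOfFintype β := by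
  classical
  ext b
  obtain ⟨a, rfl⟩ := hg.2 b
  rw [PMF.map_apply, tsum_eq_single a]
  · simp [Fintype.card_of_bijective hg]
  · intro a' ha
    rw [if_neg]
    exact fun h => ha (hg.1 h.symm)

/-- Zero information leakage: over a finite field, given pairwise distinct
nodes `x 0, x 1, …, x r` (`r ≥ 1`) and prescribed values `y 1, …, y r`, the
set `S` of polynomials of degree at most `r` matching the prescribed values is
finite and nonempty, and the pushforward of the uniform distribution on `S`
under evaluation at the fresh node `x 0` is the uniform distribution on the
field. -/
theorem map_uniform_interpolants_eval_eq_uniform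
    {F : Type*} [Field F] [Fintype F] (r : ℕ) (hr : 1 ≤ r)
    (x : Fin (r + 1) → F) (hx : Function.Injective x) (y : Fin r → F)
    [Fintype {f : Polynomial F //
        f.degree ≤ (r : WithBot ℕ) ∧ ∀ i : Fin r, f.eval (x i.succ) = y i}]
    [Nonempty {f : Polynomial F //
        f.degree ≤ (r : WithBot ℕ) ∧ ∀ i : Fin r, f.eval (x i.succ) = y i}] :
    PMF.map
      (fun f : {f : Polynomial F //
          f.degree ≤ (r : WithBot ℕ) ∧ ∀ i : Fin r, f.eval (x i.succ) = y i} =>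
        (f : Polynomial F).eval (x 0))
      (PMF.uniformOfFintype _) = PMF.uniformOfFintype F := by
  classical
  have hinj : Set.InjOn x ((Finset.univ : Finset (Fin (r + 1))) : Set (Fin (r + 1))) :=
    hx.injOn
  have hlt : ∀ f : Polynomial F, f.degree ≤ (r : WithBot ℕ) →
      f.degree < ((Finset.univ : Finset (Fin (r + 1))).card : WithBot ℕ) := by
    intro f hf
    refine lt_of_le_of_lt hf ?_
    rw [Finset.card_univ, Fintype.card_fin]
    exact_mod_cast Nat.lt_succ_self r
  apply pmf_map_uniform_of_bijective
  constructor
  · rintro ⟨f, hf, hfy⟩ ⟨g, hg, hgy⟩ h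
    apply Subtype.ext
    refine Polynomial.eq_of_degrees_lt_of_eval_index_eq Finset.univ hinj (hlt f hf) (hlt g hg) ?_
    intro i _
    refine Fin.cases h (fun j => ?_) i
    rw [hfy, hgy]
  · intro b
    let v : Fin (r + 1) → F := Fin.cons b y
    refine ⟨⟨Lagrange.interpolate Finset.univ x v, ?_, ?_⟩, ?_⟩
    · refine (Lagrange.degree_interpolate_le v hinj).trans ?_
      simp
    · intro i
      rw [Lagrange.eval_interpolate_at_node v hinj (Finset.mem_univ _)]
      simp [v]
    · change Polynomial.eval (x 0) (Lagrange.interpolate Finset.univ x v) = b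
      rw [Lagrange.eval_interpolate_at_node v hinj (Finset.mem_univ _)]
      simp [v]
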